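/- arXiv:1305.1867 — 2 statements merged into one kernel-verified Lean document; each statement's English description precedes it below -/
import Mathlib

section
/- Let p and q be odd primes with p < q such that q − 1 is not divisible by p. Then for every pair of positive integers e and f, the number p^{e·φ(q−1)}·q^{f·φ(p−1)} is a weak Carmichael number. -/
/-- The sum `∑_{1 ≤ k ≤ n−1, gcd(k,n)=1} k^(n−1)`. -/
def carmSum (n : ℕ) : ℕ :=
  ∑ k ∈ Finset.filter (fun k => Nat.Coprime k n) (Finset.range n), k ^ (n - 1)

/-- A composite positive integer `n` is a weak Carmichael number if
`∑_{1 ≤ k ≤ n−1, gcd(k,n)=1} k^(n−1) ≡ φ(n) (mod n)`. -/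
def IsWeakCarmichael (n : ℕ) : Prop :=
  1 < n ∧ ¬ n.Prime ∧ carmSum n ≡ n.totient [MOD n]

theorem sum_range_mul_eq_sum_sum (n c : ℕ) (g : ℕ → ℕ) :
    ∑ k ∈ Finset.range (n * c), g k =
      ∑ j ∈ Finset.range n, ∑ t ∈ Finset.range c, g (j + n * t) := by
  rw [Finset.sum_comm]
  induction c with
  | zero => simp
  | succ c ih =>
    rw [Nat.mul_succ, Finset.sum_range_add, ih, Finset.sum_range_succ]
    simp only [add_comm]

theorem dvd_sum_range_of_odd {p : ℕ} (hp : Odd p) : p ∣ ∑ t ∈ Finset.range p, t := by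
  have h : p ∣ (∑ t ∈ Finset.range p, t) * 2 := by
    rw [Finset.sum_range_id_mul_two]
    exact dvd_mul_right _ _
  exact (Nat.coprime_two_right.mpr hp).dvd_of_dvd_mul_right h

theorem sum_add_mul_pow_modEq {p a n : ℕ} (hp : Odd p) (ha : 0 < a) (hn : p ^ a ∣ n)
    (j m : ℕ) :
    ∑ t ∈ Finset.range p, (j + n * t) ^ m ≡ p * j ^ m [MOD p ^ (a + 1)] := by
  have hterm (t : ℕ) :
      (j + n * t) ^ m ≡ j ^ m + m * j ^ (m - 1) * n * t [MOD p ^ (a + 1)] := by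
    obtain ⟨k, hk⟩ := Polynomial.powAddExpansion j (n * t) m
    have hsq : p ^ (a + 1) ∣ k * (n * t) ^ 2 := by
      have h1 : p ^ (a + 1) ∣ (p ^ a) ^ 2 := by
        rw [← pow_mul]
        exact pow_dvd_pow p (by omega)
      exact Dvd.dvd.mul_left (h1.trans (pow_dvd_pow_of_dvd (hn.mul_right t) 2)) k
    rw [hk]
    have h := (Nat.modEq_zero_iff_dvd.mpr hsq).add_left (j ^ m + m * j ^ (m - 1) * n * t)
    simpa [mul_assoc] using h
  have hlin : p ^ (a + 1) ∣ ∑ t ∈ Finset.range p, m * j ^ (m - 1) * n * t := by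
    rw [← Finset.mul_sum, mul_assoc, pow_succ]
    exact Dvd.dvd.mul_left (mul_dvd_mul hn (dvd_sum_range_of_odd hp)) _
  refine (Nat.ModEq.sum fun t _ => hterm t).trans ?_
  rw [Finset.sum_add_distrib]
  simpa using (Nat.modEq_zero_iff_dvd.mpr hlin).add_left (p * j ^ m)

theorem pow_modEq_one_of_sub_one_dvd {p k m : ℕ} (hp : p.Prime) (hk : k.Coprime p)
    (hm : p - 1 ∣ m) : k ^ m ≡ 1 [MOD p] := by
  obtain ⟨c, rfl⟩ := hm
  have h := (Nat.ModEq.pow_totient hk).pow c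
  rwa [Nat.totient_prime hp, one_pow, ← pow_mul] at h

theorem sum_coprime_pow_modEq_totient {p m : ℕ} (hp : p.Prime) (hodd : Odd p)
    (hm : p - 1 ∣ m) (M : ℕ) {a : ℕ} (ha : 0 < a) :
    ∑ k ∈ Finset.range (p ^ a * M) with k.Coprime (p ^ a * M), k ^ m ≡
      (p ^ a * M).totient [MOD p ^ a] := by
  induction a, ha using Nat.le_induction with
  | base =>
    simp only [pow_one]
    have hcard : (p * M).totient = ∑ k ∈ Finset.range (p * M) with k.Coprime (p * M), 1 := by
      simp [Nat.totient, Nat.coprime_comm]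
    rw [hcard]
    refine Nat.ModEq.sum fun k hk => pow_modEq_one_of_sub_one_dvd hp ?_ hm
    exact (Finset.mem_filter.mp hk).2.coprime_mul_right_right
  | succ a ha ih =>
    have hpn : p ∣ p ^ a * M := (dvd_pow_self p (by omega)).mul_right M
    have hn : p ^ (a + 1) * M = p ^ a * M * p := by ring
    have hcop (j t : ℕ) :
        (j + p ^ a * M * t).Coprime (p ^ a * M * p) ↔ j.Coprime (p ^ a * M) := by
      rw [Nat.coprime_mul_iff_right, Nat.coprime_add_mul_left_left]
      refine and_iff_left_of_imp fun h => ?_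
      exact ((Nat.coprime_add_mul_left_left _ _ _).mpr h).coprime_dvd_right hpn
    rw [hn, mul_comm _ p, Nat.totient_mul_of_prime_of_dvd hp hpn, mul_comm p (p ^ a * M),
      Finset.sum_filter, sum_range_mul_eq_sum_sum]
    simp only [hcop]
    have hstep : ∑ j ∈ Finset.range (p ^ a * M), ∑ t ∈ Finset.range p,
        (if j.Coprime (p ^ a * M) then (j + p ^ a * M * t) ^ m else 0) ≡
        ∑ j ∈ Finset.range (p ^ a * M), (if j.Coprime (p ^ a * M) then p * j ^ m else 0)
        [MOD p ^ (a + 1)] := by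
      refine Nat.ModEq.sum fun j _ => ?_
      split_ifs
      · exact sum_add_mul_pow_modEq hodd ha (dvd_mul_right _ _) j m
      · simp [Nat.ModEq]
    refine hstep.trans ?_
    rw [← Finset.sum_filter, ← Finset.mul_sum, pow_succ']
    exact ih.mul_left' p

theorem pow_mul_totient_modEq_one {x n : ℕ} (h : x.Coprime n) (e : ℕ) :
    x ^ (e * n.totient) ≡ 1 [MOD n] := by
  simpa [← pow_mul, mul_comm] using (Nat.ModEq.pow_totient h).pow e

theorem modEq_one_sub_one {p : ℕ} (hp : 0 < p) : p ≡ 1 [MOD p - 1] :=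
  ((Nat.modEq_iff_dvd' hp).mpr dvd_rfl).symm

theorem stmt_10 (p q : ℕ) (hp : p.Prime) (hq : q.Prime) (hpodd : Odd p)
    (hqodd : Odd q) (hlt : p < q) (hnd : ¬ p ∣ (q - 1))
    (e f : ℕ) (he : 0 < e) (hf : 0 < f) :
    IsWeakCarmichael (p ^ (e * (q - 1).totient) * q ^ (f * (p - 1).totient)) := by
  have hp2 := hp.two_le
  have hq2 := hq.two_le
  have ha : 0 < e * (q - 1).totient := Nat.mul_pos he (Nat.totient_pos.mpr (by omega))
  have hb : 0 < f * (p - 1).totient := Nat.mul_pos hf (Nat.totient_pos.mpr (by omega))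
  have hpa := pow_mul_totient_modEq_one ((Nat.Prime.coprime_iff_not_dvd hp).mpr hnd) e
  have hqb := pow_mul_totient_modEq_one ((Nat.Prime.coprime_iff_not_dvd hq).mpr
    (Nat.not_dvd_of_pos_of_lt (n := p - 1) (by omega) (by omega))) f
  have hpq : p.Coprime q := (Nat.coprime_primes hp hq).mpr hlt.ne
  generalize e * (q - 1).totient = a at *
  generalize f * (p - 1).totient = b at *
  have h1p : 1 < p ^ a := Nat.one_lt_pow ha.ne' hp.one_lt
  have h1q : 1 < q ^ b := Nat.one_lt_pow hb.ne' hq.one_lt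
  have h1n : 1 < p ^ a * q ^ b := one_lt_mul'' h1p h1q
  have hmp : p - 1 ∣ p ^ a * q ^ b - 1 :=
    (Nat.modEq_iff_dvd' h1n.le).mp
      (by simpa using (((modEq_one_sub_one hp.pos).pow a).mul hqb).symm)
  have hmq : q - 1 ∣ p ^ a * q ^ b - 1 :=
    (Nat.modEq_iff_dvd' h1n.le).mp
      (by simpa using (hpa.mul ((modEq_one_sub_one hq.pos).pow b)).symm)
  refine ⟨h1n, Nat.not_prime_mul h1p.ne' h1q.ne', ?_⟩
  refine (Nat.modEq_and_modEq_iff_modEq_mul (hpq.pow a b)).mp ⟨?_, ?_⟩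
  · exact sum_coprime_pow_modEq_totient hp hpodd hmp (q ^ b) ha
  · have h := sum_coprime_pow_modEq_totient hq hqodd hmq (p ^ a) hb
    rwa [mul_comm (q ^ b)] at h
end

section
/- Let n be an odd composite positive integer with prime factorization n = p_1^{e_1} p_2^{e_2} ⋯ p_s^{e_s}, and let n' = p_1 p_2 ⋯ p_s be the radical of n. Then n is a weak Carmichael number if and only if λ(n') divides n − 1, where λ(m) denotes the Carmichael lambda function of m, i.e., the exponent of the multiplicative group (ℤ/mℤ)^×. -/
lemma carmSum_cast (n : ℕ) [NeZero n] :
    (carmSum n : ZMod n) = ∑ u : (ZMod n)ˣ, (u : ZMod n) ^ (n - 1) := by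
  rw [carmSum, Nat.cast_sum]
  symm
  refine Finset.sum_bij (fun u _ => (u : ZMod n).val) ?_ ?_ ?_ ?_
  · intro u _
    simpa using ⟨ZMod.val_lt _, ZMod.val_coe_unit_coprime u⟩
  · intro u _ v _ h
    exact Units.ext (ZMod.val_injective n h)
  · intro k hk
    simp only [Finset.mem_filter, Finset.mem_range] at hk
    exact ⟨ZMod.unitOfCoprime k hk.2, Finset.mem_univ _, by simp [ZMod.val_cast_of_lt hk.1]⟩
  · intro u _
    simp

/-- If a unit `g` satisfies `g ^ k ≢ 1 (mod p)`, then the sum of the `k`-th powers of all units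
modulo `n` is divisible by every power of `p` dividing `n`. -/
lemma ZMod.pow_dvd_of_sum_units_pow {n p e k S : ℕ} [NeZero n] (hp : p.Prime)
    (hpn : p ∣ n) (hpe : p ^ e ∣ n) (hS : (S : ZMod n) = ∑ u : (ZMod n)ˣ, (u : ZMod n) ^ k)
    (g : (ZMod p)ˣ) (hg : g ^ k ≠ 1) : p ^ e ∣ S := by
  obtain ⟨v, rfl⟩ := ZMod.unitsMap_surjective hpn g
  have hmul : (S : ZMod n) * ((v : ZMod n) ^ k - 1) = 0 := by
    rw [mul_sub, mul_one, sub_eq_zero, hS, Finset.sum_mul]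
    refine Fintype.sum_equiv (Equiv.mulRight v) _ _ fun u => ?_
    simp [mul_pow]
  set a : ℕ := (v : ZMod n).val with ha
  have hva : (v : ZMod n) = (a : ZMod n) := by simp [ha]
  have hdvd : (n : ℤ) ∣ (S : ℤ) * ((a : ℤ) ^ k - 1) := by
    rw [← ZMod.intCast_zmod_eq_zero_iff_dvd]
    push_cast
    rw [← hva, hmul]
  have hnot : ¬ (p : ℤ) ∣ (a : ℤ) ^ k - 1 := by
    rw [← ZMod.intCast_zmod_eq_zero_iff_dvd]
    push_cast
    rw [sub_eq_zero]
    intro h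
    apply hg
    ext
    rw [Units.val_pow_eq_pow_val, ZMod.unitsMap_val, hva, Units.val_one,
      ZMod.cast_natCast hpn, h]
  have hcop : IsCoprime ((p : ℤ) ^ e) ((a : ℤ) ^ k - 1) :=
    ((Nat.prime_iff_prime_int.mp hp).coprime_iff_not_dvd.mpr hnot).pow_left
  have : ((p ^ e : ℕ) : ℤ) ∣ S := by
    push_cast
    exact hcop.dvd_of_dvd_mul_right (dvd_trans (by exact_mod_cast hpe) hdvd)
  exact_mod_cast this

/-- If the full power of `p` in `n` divides `φ n`, then `n` has a prime factor
congruent to `1` modulo `p`. -/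
lemma Nat.exists_primeFactor_dvd_sub_one {n p : ℕ} (hn : n ≠ 0) (hp : p.Prime) (hpn : p ∣ n)
    (h : p ^ n.factorization p ∣ n.totient) : ∃ q ∈ n.primeFactors, p ∣ q - 1 := by
  rw [← (Nat.prime_iff.mp hp).dvd_finsetProd_iff]
  have h1 : p ^ n.factorization p * p ∣ n * ∏ q ∈ n.primeFactors, (q - 1) := by
    rw [← Nat.totient_mul_prod_primeFactors]
    exact mul_dvd_mul h (Finset.dvd_prod_of_mem _ (by simp [hp, hpn, hn]))
  nth_rewrite 2 [← Nat.ordProj_mul_ordCompl_eq_self n p] at h1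
  rw [mul_assoc] at h1
  have h2 := Nat.dvd_of_mul_dvd_mul_left (pow_pos hp.pos _) h1
  exact (Nat.coprime_ordCompl hp hn).dvd_of_dvd_mul_left h2

lemma prime_sub_one_dvd_of_carmSum_modEq {n : ℕ} (hn : 1 < n)
    (h : carmSum n ≡ n.totient [MOD n]) (p : ℕ) (hp : p.Prime) (hpn : p ∣ n) :
    p - 1 ∣ n - 1 := by
  have : NeZero n := ⟨by omega⟩
  induction hd : n - p using Nat.strong_induction_on generalizing p with
  | _ d ih =>
  subst hd
  have : Fact p.Prime := ⟨hp⟩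
  obtain ⟨g, hg⟩ := IsCyclic.exists_generator (α := (ZMod p)ˣ)
  have hord : orderOf g = p - 1 := by
    rw [orderOf_eq_card_of_forall_mem_zpowers hg, Nat.card_eq_fintype_card, ZMod.card_units]
  rw [← hord, orderOf_dvd_iff_pow_eq_one]
  by_contra hgk
  have hS := ZMod.pow_dvd_of_sum_units_pow hp hpn (Nat.ordProj_dvd n p) (carmSum_cast n) g hgk
  rw [(h.of_dvd (Nat.ordProj_dvd n p)).dvd_iff dvd_rfl] at hS
  obtain ⟨q, hq, hpq⟩ := Nat.exists_primeFactor_dvd_sub_one (by omega) hp hpn hS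
  have hqp := Nat.prime_of_mem_primeFactors hq
  have hqn := Nat.dvd_of_mem_primeFactors hq
  have hle := Nat.le_of_dvd (by have := hqp.two_le; omega) hpq
  have hqn' := Nat.le_of_dvd (by omega) hqn
  have hp1 := hpq.trans (ih (n - q) (by have := hp.two_le; omega) q hqp hqn rfl)
  have := (Nat.dvd_sub_iff_right hn.le hpn).mp hp1
  exact hp.one_lt.ne' (Nat.dvd_one.mp this)

lemma ZMod.exponent_units_dvd_of_prime_sub_one_dvd {n k : ℕ}
    (h : ∀ p : ℕ, p.Prime → p ∣ n → p - 1 ∣ k) :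
    Monoid.exponent (ZMod (∏ p ∈ n.primeFactors, p))ˣ ∣ k := by
  rw [Monoid.exponent_dvd_iff_forall_pow_eq_one]
  have hne : ∏ p ∈ n.primeFactors, p ≠ 0 := Finset.prod_ne_zero_iff.mpr fun p hp =>
    (Nat.prime_of_mem_primeFactors hp).ne_zero
  have hdvd (a : ℕ) (ha : a.Coprime (∏ p ∈ n.primeFactors, p)) :
      ∏ p ∈ n.primeFactors, p ∣ a ^ k - 1 := by
    refine Finset.prod_primes_dvd _
      (fun p hp => (Nat.prime_of_mem_primeFactors hp).prime) fun p hp => ?_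
    have hpp := Nat.prime_of_mem_primeFactors hp
    obtain ⟨c, hc⟩ := h p hpp (Nat.dvd_of_mem_primeFactors hp)
    have hap : a.Coprime p := ha.of_dvd_right (Finset.dvd_prod_of_mem _ hp)
    have hpos : 0 < a := by
      rcases Nat.eq_zero_or_pos a with rfl | h0
      · exact absurd ((Nat.coprime_zero_left p).mp hap) hpp.one_lt.ne'
      · exact h0
    rw [← Nat.modEq_iff_dvd' (Nat.one_le_pow _ _ hpos), hc, pow_mul]
    have := ((Nat.ModEq.pow_totient hap).pow c).symm
    rwa [one_pow, Nat.totient_prime hpp] at this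
  generalize ∏ p ∈ n.primeFactors, p = m at hne hdvd ⊢
  intro u
  have : NeZero m := ⟨hne⟩
  have h1 := hdvd _ (ZMod.val_coe_unit_coprime u)
  by_cases hm : m = 1
  · subst hm
    exact Subsingleton.elim _ _
  have hpos : 0 < (u : ZMod m).val := by
    rcases Nat.eq_zero_or_pos (u : ZMod m).val with h0 | h0
    · exact absurd ((Nat.coprime_zero_left m).mp (h0 ▸ ZMod.val_coe_unit_coprime u)) hm
    · exact h0
  rw [← Nat.modEq_iff_dvd' (Nat.one_le_pow _ _ hpos), ← ZMod.natCast_eq_natCast_iff] at h1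
  ext
  simpa using h1.symm

/-- For odd `n` and `m ∣ n` having the same prime factors, the units of `ZMod n` that are `1`
modulo `m` sum up to their number. -/
lemma ZMod.sum_ker_unitsMap {n m : ℕ} [NeZero n] (hodd : Odd n) (hmn : m ∣ n)
    (hpm : n.primeFactors = m.primeFactors) :
    ∑ u : (ZMod.unitsMap hmn).ker, ((u : (ZMod n)ˣ) : ZMod n) =
      (Nat.card (ZMod.unitsMap hmn).ker : ZMod n) := by
  have : NeZero m := ⟨fun h => NeZero.ne n (Nat.eq_zero_of_zero_dvd (h ▸ hmn))⟩
  have hunit (x : ZMod n) (hx : ZMod.castHom hmn (ZMod m) x = 1) : IsUnit x := by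
    obtain ⟨a, rfl⟩ := ZMod.natCast_zmod_surjective x
    rw [map_natCast] at hx
    have ha : a.Coprime m := (ZMod.isUnit_iff_coprime a m).mp (hx ▸ isUnit_one)
    rw [ZMod.isUnit_iff_coprime]
    refine Nat.coprime_of_dvd fun p hp hpa hpn => ?_
    have hpm' : p ∈ m.primeFactors := hpm ▸ Nat.mem_primeFactors.mpr ⟨hp, hpn, NeZero.ne n⟩
    exact Nat.not_coprime_of_dvd_of_dvd hp.one_lt hpa (Nat.dvd_of_mem_primeFactors hpm') ha
  have hmem (u : (ZMod n)ˣ) :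
      u ∈ (ZMod.unitsMap hmn).ker ↔ ZMod.castHom hmn (ZMod m) (u : ZMod n) = 1 := by
    rw [MonoidHom.mem_ker, Units.ext_iff, ZMod.unitsMap_val, Units.val_one, ZMod.castHom_apply]
  have href (u : (ZMod.unitsMap hmn).ker) :
      ZMod.castHom hmn (ZMod m) (2 - ((u : (ZMod n)ˣ) : ZMod n)) = 1 := by
    rw [map_sub, (hmem u).mp u.2, map_ofNat]
    norm_num
  let σ (u : (ZMod.unitsMap hmn).ker) : (ZMod.unitsMap hmn).ker :=
    ⟨(hunit _ (href u)).unit, (hmem _).mpr (href u)⟩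
  have hσ (u) : ((σ u : (ZMod n)ˣ) : ZMod n) = 2 - ((u : (ZMod n)ˣ) : ZMod n) := rfl
  have hinv : Function.Involutive σ := fun u => by
    ext
    rw [hσ, hσ, sub_sub_cancel]
  have h2 : IsUnit (2 : ZMod n) := by
    exact_mod_cast (ZMod.isUnit_iff_coprime 2 n).mpr (Nat.coprime_two_left.mpr hodd)
  have hsum := Equiv.sum_comp hinv.toPerm fun u => ((u : (ZMod n)ˣ) : ZMod n)
  simp only [Function.Involutive.coe_toPerm, hσ, Finset.sum_sub_distrib, Finset.sum_const,
    Finset.card_univ, nsmul_eq_mul] at hsum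
  rw [Nat.card_eq_fintype_card]
  apply h2.mul_left_cancel
  linear_combination -hsum

lemma ZMod.card_ker_unitsMap_mul {n m : ℕ} [NeZero n] (hmn : m ∣ n)
    (hpm : n.primeFactors = m.primeFactors) : Nat.card (ZMod.unitsMap hmn).ker * m = n := by
  have : NeZero m := ⟨fun h => NeZero.ne n (Nat.eq_zero_of_zero_dvd (h ▸ hmn))⟩
  have hcard : Nat.card (ZMod.unitsMap hmn).ker * m.totient = n.totient := by
    have h := (ZMod.unitsMap hmn).ker.card_mul_index
    rwa [Subgroup.index_ker, MonoidHom.range_eq_top.mpr (ZMod.unitsMap_surjective hmn),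
      Subgroup.card_top, Nat.card_eq_fintype_card (α := (ZMod m)ˣ), ZMod.card_units_eq_totient,
      Nat.card_eq_fintype_card (α := (ZMod n)ˣ), ZMod.card_units_eq_totient] at h
  have hn := Nat.totient_mul_prod_primeFactors n
  have hm := Nat.totient_mul_prod_primeFactors m
  rw [hpm, ← hcard, mul_assoc, hm, ← mul_assoc] at hn
  refine Nat.eq_of_mul_eq_mul_right (Finset.prod_pos fun p hp => ?_) hn
  exact Nat.sub_pos_of_lt (Nat.prime_of_mem_primeFactors hp).one_lt

lemma MonoidHom.sum_comp_eq_card_ker_mul {G H R : Type*} [Group G] [Fintype G] [Group H]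
    [Fintype H] [Semiring R] (f : G →* H) (hf : Function.Surjective f) (φ : H → R) :
    ∑ x, φ (f x) = Nat.card f.ker * ∑ y, φ y := by
  classical
  rw [← Finset.sum_fiberwise (g := f), Finset.mul_sum]
  refine Finset.sum_congr rfl fun y _ => ?_
  rw [Finset.sum_congr rfl fun x hx => by rw [(Finset.mem_filter.mp hx).2], Finset.sum_const,
    nsmul_eq_mul, MonoidHom.card_fiber_eq_of_mem_range f (hf y) (hf 1), Nat.card_eq_fintype_card,
    Fintype.card_subtype]
  simp only [MonoidHom.mem_ker]

lemma ZMod.sum_units_pow_eq_totient {n m : ℕ} [NeZero n] (hodd : Odd n) (hmn : m ∣ n)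
    (hpm : n.primeFactors = m.primeFactors) (h : Monoid.exponent (ZMod m)ˣ ∣ n - 1) :
    ∑ u : (ZMod n)ˣ, (u : ZMod n) ^ (n - 1) = n.totient := by
  set K := (ZMod.unitsMap hmn).ker with hK
  have hcop : (Nat.card K).Coprime (n - 1) := by
    refine Nat.Coprime.of_dvd_left ⟨m, (ZMod.card_ker_unitsMap_mul hmn hpm).symm⟩ ?_
    exact (Nat.coprime_self_sub_right (NeZero.one_le)).mpr (Nat.coprime_one_right n)
  let f : (ZMod n)ˣ →* K := (powMonoidHom (n - 1)).codRestrict K fun u => by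
    rw [hK, MonoidHom.mem_ker, powMonoidHom_apply, map_pow]
    exact Monoid.exponent_dvd_iff_forall_pow_eq_one.mp h _
  have hf : Function.Surjective f := fun k => by
    obtain ⟨x, rfl⟩ := (powCoprime hcop).surjective k
    exact ⟨x, Subtype.ext rfl⟩
  have hsum := f.sum_comp_eq_card_ker_mul hf fun k => ((k : (ZMod n)ˣ) : ZMod n)
  have hcard := f.ker.card_mul_index
  rw [Subgroup.index_ker, MonoidHom.range_eq_top.mpr hf, Subgroup.card_top,
    Nat.card_eq_fintype_card (α := (ZMod n)ˣ), ZMod.card_units_eq_totient] at hcard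
  rw [ZMod.sum_ker_unitsMap hodd hmn hpm, ← Nat.cast_mul, hcard] at hsum
  rw [← hsum]
  rfl

theorem stmt_11 (n : ℕ) (hodd : Odd n) (hn : 1 < n) (hnp : ¬ n.Prime) :
    IsWeakCarmichael n ↔
      Monoid.exponent (ZMod (∏ p ∈ n.primeFactors, p))ˣ ∣ n - 1 := by
  have : NeZero n := ⟨by omega⟩
  constructor
  · rintro ⟨-, -, h⟩
    exact ZMod.exponent_units_dvd_of_prime_sub_one_dvd (prime_sub_one_dvd_of_carmSum_modEq hn h)
  · intro h
    refine ⟨hn, hnp, ?_⟩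
    rw [← ZMod.natCast_eq_natCast_iff, carmSum_cast]
    exact ZMod.sum_units_pow_eq_totient hodd (Nat.prod_primeFactors_dvd n)
      (Nat.primeFactors_prod fun p hp => Nat.prime_of_mem_primeFactors hp).symm h
end
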